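/- Let d ∈ ℕ, let F be a finite group, let G = ℤ^d × F, let S ⊆ G be a finite monoid generating set of G, let π : ℤ^d × F → ℤ^d be the canonical projection, and let R be the diameter of the subgroup {0} × F of G with respect to the word metric d_S. Then π(S) is a finite monoid generating set of ℤ^d and for all r ∈ ℕ with r ≥ R one has β_{G,S}(r) ≥ |F| · β_{ℤ^d, π(S)}(r − R). -/

import Mathlib

/-- `S` is a monoid generating set of the group `G`: every element of `G` is a
product of finitely many elements of `S`. -/
def IsMonGenSet {G : Type*} [Group G] (S : Set G) : Prop := Submonoid.closure S = ⊤

/-- `S` is symmetric: closed under inverses. -/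
def IsSymmSet {G : Type*} [Group G] (S : Set G) : Prop := ∀ s ∈ S, s⁻¹ ∈ S

/-- The word length of `g` with respect to `S`: the least `n` such that `g` is a
product of `n` elements of `S`. -/
noncomputable def wlen {G : Type*} [Group G] (S : Set G) (g : G) : ℕ :=
  sInf {n | ∃ l : List G, (∀ x ∈ l, x ∈ S) ∧ l.length = n ∧ l.prod = g}

/-- The growth function `β_{G,S}`: the cardinality of the ball of radius `r`. -/
noncomputable def growth {G : Type*} [Group G] (S : Set G) (r : ℕ) : ℕ :=
  Set.ncard {g : G | wlen S g ≤ r}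

/-- The spherical growth function `σ_{G,S}`. -/
noncomputable def sph {G : Type*} [Group G] (S : Set G) (r : ℕ) : ℕ :=
  Set.ncard {g : G | wlen S g = r}

/-- The standard symmetric generating set `E_d ∪ (-E_d)` of `ℤ^d`. -/
def stdSymmSet (d : ℕ) : Set (Multiplicative (Fin d → ℤ)) :=
  {x | ∃ i : Fin d, x = Multiplicative.ofAdd (Pi.single i 1) ∨
       x = Multiplicative.ofAdd (-Pi.single i 1)}

/-- The standard symmetric growth function `β_d` of `ℤ^d`. -/
noncomputable def betaStd (d : ℕ) : ℕ → ℕ := growth (stdSymmSet d)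

/-- The standard monoid generating set `E_d ∪ {v_d}` of `ℤ^d`. -/
def stdMonSet (d : ℕ) : Set (Multiplicative (Fin d → ℤ)) :=
  {x | (∃ i : Fin d, x = Multiplicative.ofAdd (Pi.single i 1)) ∨
       x = Multiplicative.ofAdd (fun _ => (-1 : ℤ))}

/-- The standard monoid growth function `β⁺_d` of `ℤ^d`. -/
noncomputable def betaPlus (d : ℕ) : ℕ → ℕ := growth (stdMonSet d)

/-- The rank of a finitely generated abelian group. -/
noncomputable def rk (G : Type*) [CommGroup G] : ℕ := Module.finrank ℤ (Additive G)

/-- Every element of a group generated by `S` as a monoid is realised by a word of length `wlen S g`. -/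
theorem exists_list_length_eq_wlen {G : Type*} [Group G] {S : Set G} (hgen : IsMonGenSet S)
    (g : G) : ∃ l : List G, (∀ x ∈ l, x ∈ S) ∧ l.length = wlen S g ∧ l.prod = g := by
  have hg : g ∈ Submonoid.closure S := by rw [show Submonoid.closure S = ⊤ from hgen]; trivial
  obtain ⟨l, hl, hp⟩ := Submonoid.exists_list_of_mem_closure hg
  exact Nat.sInf_mem (s := {n | ∃ l : List G, (∀ x ∈ l, x ∈ S) ∧ l.length = n ∧ l.prod = g})
    ⟨l.length, l, hl, rfl, hp⟩

theorem wlen_prod_le_length {G : Type*} [Group G] {S : Set G} {l : List G}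
    (hl : ∀ x ∈ l, x ∈ S) : wlen S l.prod ≤ l.length :=
  Nat.sInf_le ⟨l, hl, rfl, rfl⟩

theorem wlen_mul_le {G : Type*} [Group G] {S : Set G} (hgen : IsMonGenSet S) (g h : G) :
    wlen S (g * h) ≤ wlen S g + wlen S h := by
  obtain ⟨l, hl, hlen, rfl⟩ := exists_list_length_eq_wlen hgen g
  obtain ⟨m, hm, hmlen, rfl⟩ := exists_list_length_eq_wlen hgen h
  rw [← hlen, ← hmlen, ← List.prod_append, ← List.length_append]
  exact wlen_prod_le_length fun x hx => (List.mem_append.1 hx).elim (hl x) (hm x)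

/-- Balls for the word metric of a finite generating set are finite. -/
theorem finite_setOf_wlen_le {G : Type*} [Group G] {S : Set G} (hS : S.Finite)
    (hgen : IsMonGenSet S) (r : ℕ) : {g : G | wlen S g ≤ r}.Finite := by
  have : Finite S := hS
  refine ((List.finite_length_le S r).image fun l => (l.map Subtype.val).prod).subset ?_
  intro g hg
  obtain ⟨l, hl, hlen, hp⟩ := exists_list_length_eq_wlen hgen g
  lift l to List S using hl
  exact ⟨l, by simpa [← hlen] using hg, hp⟩

theorem IsMonGenSet.image {G H : Type*} [Group G] [Group H] {S : Set G} (hgen : IsMonGenSet S)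
    {φ : G →* H} (hφ : Function.Surjective φ) : IsMonGenSet (φ '' S) := by
  unfold IsMonGenSet at *
  rw [← MonoidHom.map_mclosure, hgen, ← MonoidHom.mrange_eq_map,
    MonoidHom.mrange_eq_top_of_surjective φ hφ]

/-- Elements of the image group lift without increasing the word length. -/
theorem exists_lift_wlen_le {G H : Type*} [Group G] [Group H] {S : Set G} {φ : G →* H}
    (hgen : IsMonGenSet (φ '' S)) (a : H) : ∃ g : G, φ g = a ∧ wlen S g ≤ wlen (φ '' S) a := by
  obtain ⟨l, hl, hlen, rfl⟩ := exists_list_length_eq_wlen hgen a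
  obtain ⟨m, hm, rfl⟩ : ∃ m : List G, (∀ x ∈ m, x ∈ S) ∧ m.map φ = l := by
    choose! s hs hφs using hl
    refine ⟨l.map s, by simpa using hs, ?_⟩
    rw [List.map_map]
    exact (List.map_congr_left hφs).trans (List.map_id l)
  exact ⟨m.prod, map_list_prod φ m, by
    rw [← hlen, List.length_map]; exact wlen_prod_le_length hm⟩

/-- Reduction to the free Abelian case: for `G = ℤ^d × F` with `F` finite, a finite
monoid generating set `S` of `G`, the projection `π(S)` to `ℤ^d` is a monoid
generating set, and with `R` the diameter of `{0} × F` with respect to `d_S` one has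
`β_{G,S}(r) ≥ |F| · β_{ℤ^d, π(S)}(r - R)` for all `r ≥ R`. -/
theorem card_mul_growth_projection_le_growth (d : ℕ) (F : Type*) [Group F] [Finite F]
    (S : Set (Multiplicative (Fin d → ℤ) × F)) (hS : S.Finite) (hgen : IsMonGenSet S) :
    IsMonGenSet (Prod.fst '' S) ∧
    ∀ r : ℕ,
      sSup {n : ℕ | ∃ f f' : F,
          wlen S ((((1 : Multiplicative (Fin d → ℤ)), f'))⁻¹ * (1, f)) = n} ≤ r →
      Nat.card F *
          growth (Prod.fst '' S)
            (r - sSup {n : ℕ | ∃ f f' : F,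
              wlen S ((((1 : Multiplicative (Fin d → ℤ)), f'))⁻¹ * (1, f)) = n}) ≤
        growth S r := by
  have hgen' : IsMonGenSet (Prod.fst '' S) :=
    hgen.image (φ := MonoidHom.fst _ F) Prod.fst_surjective
  refine ⟨hgen', fun r hr => ?_⟩
  set D : Set ℕ := {n : ℕ | ∃ f f' : F,
    wlen S ((((1 : Multiplicative (Fin d → ℤ)), f'))⁻¹ * (1, f)) = n} with hD
  have hbdd : BddAbove D := by
    refine ((Set.finite_range fun p : F × F =>
      wlen S ((((1 : Multiplicative (Fin d → ℤ)), p.2))⁻¹ * (1, p.1))).subset ?_).bddAbove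
    rintro n ⟨f, f', rfl⟩
    exact ⟨(f, f'), rfl⟩
  have hF (f : F) : wlen S ((1 : Multiplicative (Fin d → ℤ)), f) ≤ sSup D :=
    le_csSup hbdd ⟨f, 1, by simp⟩
  choose lift hlift hlen using
    exists_lift_wlen_le (φ := MonoidHom.fst (Multiplicative (Fin d → ℤ)) F) hgen'
  have hfst (a) : (lift a).1 = a := hlift a
  unfold growth
  rw [← Set.ncard_univ, ← Set.ncard_prod]
  refine Set.ncard_le_ncard_of_injOn (fun p => lift p.2 * (1, p.1)) ?_ ?_
    (finite_setOf_wlen_le hS hgen r)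
  · rintro ⟨f, a⟩ ⟨-, ha⟩
    have h₁ := wlen_mul_le hgen (lift a) (1, f)
    have h₂ : wlen S (lift a) ≤ r - sSup D := (hlen a).trans ha
    have h₃ := hF f
    change wlen S (lift a * (1, f)) ≤ r
    omega
  · rintro ⟨f, a⟩ - ⟨f', a'⟩ - h
    obtain rfl : a = a' := by simpa [hfst] using congrArg Prod.fst h
    simpa using h
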